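/- Let γ > 0, let γ′ > γ/2 with γ′ > 0, and let c > 0. There exists a constant C > 0, depending only on γ, γ′ and c, such that for every ε ∈ (0,1] with c·ε ≤ 1/4, every T ≥ 0, and all measurable functions u, v : [0,T] × ℝ³ → ℝ satisfying |u(t,x)| ≤ √ε·(1+t+|q|)^{−(1−cε)}·(1+|q|)^{−γ′} and |v(t,x)| ≤ √ε·(1+t+|q|)^{−(1−cε)}·(1+|q|)^{−(1+γ′)} for all (t,x), where q = |x| − t, one has ∫₀^T ∫_{ℝ³} ((1+t)/ε)·u(t,x)²·v(t,x)²·w_γ(q) dx dt ≤ C·((1+T)^{4cε} − 1). -/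

import Mathlib

open MeasureTheory

noncomputable section

/-- The weight `w_γ` of the energy norm: `w_γ(q) = (1+|q|)^(1+2γ)` for `q > 0`
and `w_γ(q) = 1` for `q ≤ 0`. -/
def wWeight (γ : ℝ) (q : ℝ) : ℝ := if 0 < q then (1 + |q|) ^ (1 + 2 * γ) else 1

lemma aux_space (δ : ℝ) (hδ : 0 < δ) : ∃ K > (0 : ℝ), ∀ t : ℝ, 0 ≤ t →
    Integrable (fun x : EuclideanSpace ℝ (Fin 3) =>
      (1 + t + |‖x‖ - t|) ^ (-2 : ℝ) * (1 + |‖x‖ - t|) ^ (-(1 + δ))) ∧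
    (∫ x : EuclideanSpace ℝ (Fin 3),
      (1 + t + |‖x‖ - t|) ^ (-2 : ℝ) * (1 + |‖x‖ - t|) ^ (-(1 + δ))) ≤ K := by
  have hI : Integrable (fun q : ℝ => (1 + |q|) ^ (-(1 + δ))) := by
    have := integrable_one_add_norm (E := ℝ) (μ := volume) (r := 1 + δ) (by simp [hδ])
    simpa using this
  have hJ0 : 0 ≤ ∫ q : ℝ, (1 + |q|) ^ (-(1 + δ)) :=
    integral_nonneg fun q => by positivity
  set J := ∫ q : ℝ, (1 + |q|) ^ (-(1 + δ)) with hJ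
  set V := (volume : Measure (EuclideanSpace ℝ (Fin 3))).real (Metric.ball 0 1) with hV
  have hV0 : 0 ≤ V := measureReal_nonneg
  refine ⟨3 * V * J + 1, by positivity, fun t ht => ?_⟩
  have hIt : Integrable (fun r : ℝ => (1 + |r - t|) ^ (-(1 + δ))) := hI.comp_sub_right t
  have hb : ∀ r : ℝ, 0 < r → r ^ 2 * ((1 + t + |r - t|) ^ (-2 : ℝ) * (1 + |r - t|) ^ (-(1 + δ)))
      ≤ (1 + |r - t|) ^ (-(1 + δ)) := by
    intro r hr
    have h1 : r ≤ 1 + t + |r - t| := by linarith [le_abs_self (r - t)]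
    have hA : 0 < 1 + t + |r - t| := by positivity
    have h2 : r ^ 2 * (1 + t + |r - t|) ^ (-2 : ℝ) ≤ 1 := by
      rw [Real.rpow_neg hA.le, Real.rpow_two, ← div_eq_mul_inv, div_le_one (by positivity)]
      gcongr
    rw [← mul_assoc]
    exact mul_le_of_le_one_left (by positivity) h2
  have hR : IntegrableOn (fun r : ℝ => r ^ 2 *
      ((1 + t + |r - t|) ^ (-2 : ℝ) * (1 + |r - t|) ^ (-(1 + δ)))) (Set.Ioi 0) := by
    refine Integrable.mono' hIt.integrableOn ?_ ?_
    · exact (by fun_prop : Measurable _).aestronglyMeasurable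
    · refine (ae_restrict_iff' measurableSet_Ioi).2 (.of_forall fun r hr => ?_)
      rw [Real.norm_of_nonneg (by positivity)]
      exact hb r hr
  constructor
  · have := (integrable_fun_norm_addHaar (E := EuclideanSpace ℝ (Fin 3)) volume (f := fun r : ℝ =>
      (1 + t + |r - t|) ^ (-2 : ℝ) * (1 + |r - t|) ^ (-(1 + δ)))).2
    apply this
    simpa using hR
  · have := integral_fun_norm_addHaar (E := EuclideanSpace ℝ (Fin 3)) volume (fun r : ℝ =>
      (1 + t + |r - t|) ^ (-2 : ℝ) * (1 + |r - t|) ^ (-(1 + δ)))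
    rw [this]
    simp only [finrank_euclideanSpace, Fintype.card_fin, smul_eq_mul, nsmul_eq_mul, ← hV]
    have h3 : (∫ r in Set.Ioi (0:ℝ), r ^ (3 - 1) *
      ((1 + t + |r - t|) ^ (-2 : ℝ) * (1 + |r - t|) ^ (-(1 + δ)))) ≤ J := by
      calc _ ≤ ∫ r in Set.Ioi (0:ℝ), (1 + |r - t|) ^ (-(1 + δ)) :=
            setIntegral_mono_on hR hIt.integrableOn measurableSet_Ioi fun r hr => hb r hr
        _ ≤ ∫ r : ℝ, (1 + |r - t|) ^ (-(1 + δ)) :=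
            setIntegral_le_integral hIt (.of_forall fun r => by
              simp only [Pi.zero_apply]; positivity)
        _ = J := integral_sub_right_eq_self (fun r : ℝ => (1 + |r|) ^ (-(1 + δ))) t
    have := mul_le_mul_of_nonneg_left h3 (by positivity : 0 ≤ 3 * V)
    push_cast
    linarith

lemma wWeight_nonneg (γ q : ℝ) : 0 ≤ wWeight γ q := by
  unfold wWeight; split_ifs <;> positivity

lemma wWeight_le (γ q : ℝ) (hγ : 0 < γ) : wWeight γ q ≤ (1 + |q|) ^ (1 + 2 * γ) := by
  unfold wWeight
  split_ifs
  · exact le_rfl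
  · exact Real.one_le_rpow (by linarith [abs_nonneg q]) (by linarith)

lemma aux_point (γ γ' c ε t q a b : ℝ) (hγ : 0 < γ) (hε : 0 < ε) (hce : c * ε ≤ 1 / 4)
    (ht : 0 ≤ t)
    (ha : |a| ≤ Real.sqrt ε * (1 + t + |q|) ^ (-(1 - c * ε)) * (1 + |q|) ^ (-γ'))
    (hb : |b| ≤ Real.sqrt ε * (1 + t + |q|) ^ (-(1 - c * ε)) * (1 + |q|) ^ (-(1 + γ'))) :
    ((1 + t) / ε) * a ^ 2 * b ^ 2 * wWeight γ q ≤
      (ε * (1 + t) ^ (4 * c * ε - 1)) *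
        ((1 + t + |q|) ^ (-2 : ℝ) * (1 + |q|) ^ (-(1 + (4 * γ' - 2 * γ)))) := by
  have hP : 0 < 1 + t + |q| := by positivity
  have hQ : 0 < 1 + |q| := by positivity
  have ht1 : 0 < 1 + t := by positivity
  have hs : Real.sqrt ε ^ 2 = ε := Real.sq_sqrt hε.le
  have e1 : ∀ x y : ℝ, 0 < x → (x ^ y) ^ 2 = x ^ (2 * y) := fun x y hx => by
    rw [← Real.rpow_natCast, ← Real.rpow_mul hx.le]; congr 1; push_cast; ring
  have ha2 : a ^ 2 ≤ ε * (1 + t + |q|) ^ (2 * (-(1 - c * ε))) * (1 + |q|) ^ (2 * (-γ')) := by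
    rw [← sq_abs a, ← e1 _ _ hP, ← e1 _ _ hQ]
    nth_rewrite 1 [← hs]
    rw [← mul_pow, ← mul_pow]
    gcongr
  have hb2 : b ^ 2 ≤ ε * (1 + t + |q|) ^ (2 * (-(1 - c * ε))) * (1 + |q|) ^ (2 * (-(1 + γ'))) := by
    rw [← sq_abs b, ← e1 _ _ hP, ← e1 _ _ hQ]
    nth_rewrite 1 [← hs]
    rw [← mul_pow, ← mul_pow]
    gcongr
  have hw := wWeight_le γ q hγ
  have hw0 := wWeight_nonneg γ q
  calc _ ≤ ((1 + t) / ε) * (ε * (1 + t + |q|) ^ (2 * (-(1 - c * ε))) * (1 + |q|) ^ (2 * (-γ')))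
        * (ε * (1 + t + |q|) ^ (2 * (-(1 - c * ε))) * (1 + |q|) ^ (2 * (-(1 + γ'))))
        * (1 + |q|) ^ (1 + 2 * γ) := by gcongr
    _ = ε * (1 + t) * ((1 + t + |q|) ^ (2 * (-(1 - c * ε))) * (1 + t + |q|) ^ (2 * (-(1 - c * ε))))
        * ((1 + |q|) ^ (2 * (-γ')) * (1 + |q|) ^ (2 * (-(1 + γ'))) * (1 + |q|) ^ (1 + 2 * γ)) := by
          field_simp
    _ = ε * (1 + t) * ((1 + t + |q|) ^ (4 * c * ε - 2) * (1 + t + |q|) ^ (-2 : ℝ))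
        * (1 + |q|) ^ (-(1 + (4 * γ' - 2 * γ))) := by
          rw [← Real.rpow_add hP, ← Real.rpow_add hP, ← Real.rpow_add hQ, ← Real.rpow_add hQ]
          congr 3 <;> ring
    _ ≤ ε * (1 + t) * ((1 + t) ^ (4 * c * ε - 2) * (1 + t + |q|) ^ (-2 : ℝ))
        * (1 + |q|) ^ (-(1 + (4 * γ' - 2 * γ))) := by
          have : (1 + t + |q|) ^ (4 * c * ε - 2) ≤ (1 + t) ^ (4 * c * ε - 2) :=
            Real.rpow_le_rpow_of_nonpos ht1 (by linarith [abs_nonneg q]) (by linarith)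
          gcongr
    _ = _ := by
          rw [show 4 * c * ε - 1 = 1 + (4 * c * ε - 2) by ring, Real.rpow_add ht1, Real.rpow_one]
          ring

lemma aux_time (s T : ℝ) (hs : 0 < s) (hT : 0 ≤ T) :
    IntegrableOn (fun t : ℝ => (1 + t) ^ (s - 1)) (Set.Icc 0 T) ∧
    ∫ t in Set.Icc (0 : ℝ) T, (1 + t) ^ (s - 1) = ((1 + T) ^ s - 1) / s := by
  constructor
  · refine ContinuousOn.integrableOn_Icc ?_
    refine ContinuousOn.rpow_const (by fun_prop) fun t ht => Or.inl ?_
    have := ht.1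
    positivity
  · rw [integral_Icc_eq_integral_Ioc, ← intervalIntegral.integral_of_le hT,
      intervalIntegral.integral_comp_add_left (fun x : ℝ => x ^ (s - 1)) 1,
      integral_rpow (Or.inl (by linarith))]
    simp

theorem bad_nonlinearity_phi_dphi_estimate
    (γ γ' c : ℝ) (hγ : 0 < γ) (hγ' : γ / 2 < γ') (hγ'0 : 0 < γ') (hc : 0 < c) :
    ∃ C > (0 : ℝ), ∀ ε : ℝ, 0 < ε → ε ≤ 1 → c * ε ≤ 1 / 4 → ∀ T : ℝ, 0 ≤ T →
      ∀ u v : ℝ × EuclideanSpace ℝ (Fin 3) → ℝ, Measurable u → Measurable v →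
      (∀ t ∈ Set.Icc (0 : ℝ) T, ∀ x : EuclideanSpace ℝ (Fin 3),
        |u (t, x)| ≤ Real.sqrt ε * (1 + t + |‖x‖ - t|) ^ (-(1 - c * ε))
          * (1 + |‖x‖ - t|) ^ (-γ')) →
      (∀ t ∈ Set.Icc (0 : ℝ) T, ∀ x : EuclideanSpace ℝ (Fin 3),
        |v (t, x)| ≤ Real.sqrt ε * (1 + t + |‖x‖ - t|) ^ (-(1 - c * ε))
          * (1 + |‖x‖ - t|) ^ (-(1 + γ'))) →
      (∫ t in Set.Icc (0 : ℝ) T, ∫ x : EuclideanSpace ℝ (Fin 3),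
          ((1 + t) / ε) * u (t, x) ^ 2 * v (t, x) ^ 2 * wWeight γ (‖x‖ - t))
        ≤ C * ((1 + T) ^ (4 * c * ε) - 1) := by
  obtain ⟨K, hK, hKt⟩ := aux_space (4 * γ' - 2 * γ) (by linarith)
  refine ⟨K / (4 * c), by positivity, ?_⟩
  intro ε hε _ hce T hT u v _ _ hu hv
  obtain ⟨hi, he⟩ := aux_time (4 * c * ε) T (by positivity) hT
  have hnn : ∀ t ∈ Set.Icc (0 : ℝ) T, ∀ x : EuclideanSpace ℝ (Fin 3),
      0 ≤ ((1 + t) / ε) * u (t, x) ^ 2 * v (t, x) ^ 2 * wWeight γ (‖x‖ - t) := by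
    intro t ht x
    have := ht.1
    have := wWeight_nonneg γ (‖x‖ - t)
    positivity
  calc _ ≤ ∫ t in Set.Icc (0 : ℝ) T, (ε * K) * (1 + t) ^ (4 * c * ε - 1) := by
        refine integral_mono_of_nonneg ?_ (hi.const_mul _) ?_
        · refine (ae_restrict_iff' measurableSet_Icc).2 (.of_forall fun t ht => ?_)
          exact integral_nonneg (hnn t ht)
        · refine (ae_restrict_iff' measurableSet_Icc).2 (.of_forall fun t ht => ?_)
          obtain ⟨h1, h2⟩ := hKt t ht.1
          have ht0 := ht.1
          have h3 := integral_mono_of_nonneg (.of_forall (hnn t ht))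
            (h1.const_mul (ε * (1 + t) ^ (4 * c * ε - 1)))
            (.of_forall fun x => aux_point γ γ' c ε t (‖x‖ - t) (u (t, x)) (v (t, x)) hγ hε hce
              ht.1 (hu t ht x) (hv t ht x))
          rw [integral_const_mul] at h3
          refine h3.trans ?_
          have := mul_le_mul_of_nonneg_left h2
            (by positivity : 0 ≤ ε * (1 + t) ^ (4 * c * ε - 1))
          refine this.trans (le_of_eq ?_)
          ring
    _ = _ := by
        rw [integral_const_mul, he]
        field_simp

end
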